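/- arXiv:1310.3674 — 2 statements merged into one kernel-verified Lean document; each statement's English description precedes it below -/
import Mathlib

section
/- For every n ≥ 2, the (n+2)-ary Boolean relation R = { (x₁,…,xₙ,x,c₁) ∈ Bool^{n+2} | (x₁ ∨ ⋯ ∨ xₙ) ∧ (x → x₁ ∧ ⋯ ∧ xₙ) ∧ (c₁ = 1) } is a weak base of the co-clone it generates (this co-clone is IS^n_{01} in Post's lattice): for every finite set Δ of Boolean relations with Pol(Δ) = Pol({R}) one has pPol(Δ) ⊆ pPol({R}). -/
/-- A Boolean relation of arity `k`: a set of `k`-tuples over `Bool`. -/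
abbrev BRel (k : ℕ) := Set (Fin k → Bool)

/-- A total `m`-ary Boolean operation `f` preserves a `k`-ary relation `R`. -/
def Preserves {m k : ℕ} (f : (Fin m → Bool) → Bool) (R : BRel k) : Prop :=
  ∀ ts : Fin m → Fin k → Bool, (∀ j, ts j ∈ R) → (fun i => f (fun j => ts j i)) ∈ R

/-- A partial `m`-ary Boolean operation (modelled with `Option Bool`; `none` =
undefined) preserves a `k`-ary relation `R`. -/
def PPreserves {m k : ℕ} (f : (Fin m → Bool) → Option Bool) (R : BRel k) : Prop :=
  ∀ ts : Fin m → Fin k → Bool, (∀ j, ts j ∈ R) →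
    ∀ u : Fin k → Bool, (∀ i, f (fun j => ts j i) = some (u i)) → u ∈ R

/-- The set of all (finitary, total) polymorphisms of a set of relations. -/
def Pol (Γ : Set (Σ k, BRel k)) : Set (Σ m, (Fin m → Bool) → Bool) :=
  { f | ∀ R ∈ Γ, Preserves f.2 R.2 }

/-- The set of all partial polymorphisms of a set of relations. -/
def pPol (Γ : Set (Σ k, BRel k)) : Set (Σ m, (Fin m → Bool) → Option Bool) :=
  { f | ∀ R ∈ Γ, PPreserves f.2 R.2 }

/-- `R` is a weak base of the co-clone it generates: every finite `Δ` with the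
same polymorphisms as `R` satisfies `pPol Δ ⊆ pPol {R}`. -/
def IsWeakBase {k : ℕ} (R : BRel k) : Prop :=
  ∀ Δ : Set (Σ k, BRel k), Δ.Finite →
    Pol Δ = Pol {⟨k, R⟩} → pPol Δ ⊆ pPol {⟨k, R⟩}

/-- The relation `(x₁ ∨ ⋯ ∨ xₙ) ∧ (x → x₁ ∧ ⋯ ∧ xₙ) ∧ (c₁ = 1)`. -/
def orImpRel (n : ℕ) : BRel (n + 2) :=
  { t : Fin (n + 2) → Bool |
      (∃ i : Fin n, t (i.castAdd 2) = true) ∧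
      (t (Fin.last n).castSucc = true → ∀ i : Fin n, t (i.castAdd 2) = true) ∧
      t (Fin.last (n + 1)) = true }

/-- If total operations `g j` preserving `Δ` are such that `f ∘ g` is everywhere defined with
values `F`, then `F` preserves `Δ` whenever the partial operation `f` does. -/
theorem comp_mem_pol {Δ : Set (Σ k, BRel k)} {m M : ℕ} {f : (Fin m → Bool) → Option Bool}
    (hf : (⟨m, f⟩ : Σ m, (Fin m → Bool) → Option Bool) ∈ pPol Δ)
    {g : Fin m → (Fin M → Bool) → Bool}
    (hg : ∀ j, (⟨M, g j⟩ : Σ m, (Fin m → Bool) → Bool) ∈ Pol Δ)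
    {F : (Fin M → Bool) → Bool} (hF : ∀ y, f (fun j => g j y) = some (F y)) :
    (⟨M, F⟩ : Σ m, (Fin m → Bool) → Bool) ∈ Pol Δ := fun P hP ss hss =>
  hf P hP (fun j i => g j (fun l => ss l i)) (fun j => hg j P hP ss hss) _ fun _ => hF _

/-- The index of a coordinate of `orImpRel n` assigned to a vector `y`: the zero vector goes to
the coordinate of `x`, the `i`-th unit vector to that of `xᵢ`, all others to that of `c₁`. -/
noncomputable def coordOf (n : ℕ) (y : Fin n → Bool) : Fin (n + 2) :=
  open Classical in
  if h : ∃ i, y = fun l => decide (l = i) then h.choose.castAdd 2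
  else if y = fun _ => false then (Fin.last n).castSucc else Fin.last (n + 1)

theorem coordOf_unit {n : ℕ} (i : Fin n) :
    coordOf n (fun l => decide (l = i)) = i.castAdd 2 := by
  have h : ∃ i', (fun l : Fin n => decide (l = i)) = fun l => decide (l = i') := ⟨i, rfl⟩
  have hc : i = h.choose := by simpa using congrFun h.choose_spec i
  rw [coordOf, dif_pos h, ← hc]

theorem coordOf_zero {n : ℕ} : coordOf n (fun _ => false) = (Fin.last n).castSucc := by
  have h : ¬ ∃ i, (fun _ : Fin n => false) = fun l => decide (l = i) := by
    rintro ⟨i, hi⟩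
    simpa using congrFun hi i
  rw [coordOf, dif_neg h, if_pos rfl]

theorem coordOf_of_two {n : ℕ} {y : Fin n → Bool} {i j : Fin n} (hij : i ≠ j)
    (hi : y i = true) (hj : y j = true) : coordOf n y = Fin.last (n + 1) := by
  have h : ¬ ∃ i, y = fun l => decide (l = i) := by
    rintro ⟨k, rfl⟩
    simp_all
  have h0 : ¬ y = fun _ => false := by
    rintro rfl
    simp at hi
  rw [coordOf, dif_neg h, if_neg h0]

theorem zero_or_unit_or_two {n : ℕ} (y : Fin n → Bool) :
    (y = fun _ => false) ∨ (∃ i, y = fun l => decide (l = i)) ∨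
      ∃ i j, i ≠ j ∧ y i = true ∧ y j = true := by
  by_cases h0 : ∃ i, y i = true
  · obtain ⟨i, hi⟩ := h0
    by_cases h1 : ∃ j, i ≠ j ∧ y j = true
    · exact Or.inr (Or.inr ⟨i, h1.choose, h1.choose_spec.1, hi, h1.choose_spec.2⟩)
    · refine Or.inr (Or.inl ⟨i, funext fun l => ?_⟩)
      by_cases hl : l = i
      · simp [hl, hi]
      · simpa [hl] using fun h => h1 ⟨l, Ne.symm hl, h⟩
  · exact Or.inl (funext fun l => by simpa using fun h => h0 ⟨l, h⟩)

theorem apply_coordOf_of_apply {n : ℕ} {t : Fin (n + 2) → Bool} (ht : t ∈ orImpRel n)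
    {y : Fin n → Bool} {i : Fin n} (hi : t (i.castAdd 2) = true)
    (hy : y i = true) : t (coordOf n y) = true := by
  rcases zero_or_unit_or_two y with rfl | ⟨j, rfl⟩ | ⟨j, k, hjk, hj, hk⟩
  · simp at hy
  · obtain rfl : i = j := by simpa using hy
    rwa [coordOf_unit]
  · rw [coordOf_of_two hjk hj hk]
    exact ht.2.2

theorem apply_coordOf_mono {n : ℕ} {t : Fin (n + 2) → Bool} (ht : t ∈ orImpRel n)
    {y z : Fin n → Bool} (hyz : ∀ l, y l = true → z l = true)
    (h : t (coordOf n y) = true) : t (coordOf n z) = true := by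
  rcases zero_or_unit_or_two y with rfl | ⟨j, rfl⟩ | ⟨j, k, hjk, hj, hk⟩
  · rw [coordOf_zero] at h
    rcases zero_or_unit_or_two z with rfl | ⟨j, rfl⟩ | ⟨j, k, hjk, hj, hk⟩
    · rwa [coordOf_zero]
    · rw [coordOf_unit]
      exact ht.2.1 h j
    · rw [coordOf_of_two hjk hj hk]
      exact ht.2.2
  · rw [coordOf_unit] at h
    exact apply_coordOf_of_apply ht h (hyz j (by simp))
  · rw [coordOf_of_two hjk (hyz j hj) (hyz k hk)]
    exact ht.2.2

theorem coordOf_one {n : ℕ} (hn : 2 ≤ n) {y : Fin n → Bool} (hy : ∀ l, y l = true) :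
    coordOf n y = Fin.last (n + 1) :=
  coordOf_of_two (i := ⟨0, by omega⟩) (j := ⟨1, by omega⟩) (by simp) (hy _) (hy _)

theorem preserves_apply_coordOf {n : ℕ} (hn : 2 ≤ n) {t : Fin (n + 2) → Bool}
    (ht : t ∈ orImpRel n) : Preserves (fun y => t (coordOf n y)) (orImpRel n) := by
  intro ss hss
  refine ⟨?_, fun h i => apply_coordOf_mono ht (fun l hl => (hss l).2.1 hl i) h, ?_⟩
  · obtain ⟨i, hi⟩ := ht.1
    obtain ⟨k, hk⟩ := (hss i).1
    exact ⟨k, apply_coordOf_of_apply ht hi hk⟩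
  · change t (coordOf n _) = true
    rw [coordOf_one hn fun l => (hss l).2.2]
    exact ht.2.2

theorem mem_of_preserves_apply_coordOf {n : ℕ} (hn : 2 ≤ n) {u : Fin (n + 2) → Bool}
    (hu : Preserves (fun y => u (coordOf n y)) (orImpRel n)) : u ∈ orImpRel n := by
  have key := hu (fun l i => decide ((l : ℕ) = i) || decide ((i : ℕ) = n + 1)) fun l =>
    ⟨⟨l, by simp⟩, fun h => by
      have hl : (l : ℕ) ≠ n := l.isLt.ne
      simp [hl] at h, by simp⟩
  convert key using 1
  funext i
  congr 1
  rcases lt_trichotomy (i : ℕ) n with hi | hi | hi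
  · refine (coordOf_unit ⟨i, hi⟩).symm.trans (congrArg _ (funext fun l => ?_))
    have : (i : ℕ) ≠ n + 1 := by omega
    simp [this, Fin.ext_iff]
  · rw [show i = (Fin.last n).castSucc from Fin.ext hi, ← coordOf_zero]
    refine congrArg _ (funext fun l => ?_)
    have hl : (l : ℕ) ≠ n := l.isLt.ne
    simp [coordOf_zero, hl]
  · have hi' : (i : ℕ) = n + 1 := by omega
    rw [coordOf_one hn fun l => by simp [hi']]
    exact Fin.ext hi'

theorem stmt6 (n : ℕ) (hn : 2 ≤ n) :
    IsWeakBase { t : Fin (n + 2) → Bool |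
      (∃ i : Fin n, t (Fin.castLE (by omega) i) = true) ∧
      (t ⟨n, by omega⟩ = true → ∀ i : Fin n, t (Fin.castLE (by omega) i) = true) ∧
      t ⟨n + 1, by omega⟩ = true } := by
  change IsWeakBase (orImpRel n)
  rintro Δ - hΔ ⟨m, f⟩ hf _ rfl ts hts u hu
  have hg (j : Fin m) :
      (⟨n, fun y => ts j (coordOf n y)⟩ : Σ m, (Fin m → Bool) → Bool) ∈ Pol Δ := by
    rw [hΔ]
    rintro _ rfl
    exact preserves_apply_coordOf hn (hts j)
  have hF := comp_mem_pol hf hg (F := fun y => u (coordOf n y)) fun y => hu (coordOf n y)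
  rw [hΔ] at hF
  exact mem_of_preserves_apply_coordOf hn (hF _ rfl)
end

section
/- The 8-ary Boolean relation R = { (x₁,x₂,x₃,x₄,x₅,x₆,c₀,c₁) ∈ Bool^8 | exactly one of x₁,x₂,x₃ equals 1, x₄ = ¬x₁, x₅ = ¬x₂, x₆ = ¬x₃, c₀ = 0, c₁ = 1 } is a weak base of the co-clone it generates (this co-clone is BR, the co-clone of all Boolean relations): for every finite set Δ of Boolean relations with Pol(Δ) = Pol({R}) one has pPol(Δ) ⊆ pPol({R}). -/
/-- A relation whose tuples are `T 0, …, T (n - 1)`, and in which every `n`-tuple of Booleans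
occurs as a column of the matrix `T`, is a weak base of the co-clone it generates. -/
theorem isWeakBase_range {n k : ℕ} (T : Fin n → Fin k → Bool)
    (hT : ∀ c : Fin n → Bool, ∃ i, (fun a => T a i) = c) : IsWeakBase (Set.range T) := by
  rintro Δ - hPol ⟨m, g⟩ hg _ rfl ts hts u hu
  choose σ hσ using hts
  choose e he using hT
  have hge (c : Fin n → Bool) : g (fun j => c (σ j)) = some (u (e c)) := by
    have h := hu (e c)
    simp only [← hσ] at h
    rw [← h]
    exact congrArg g (funext fun j => (congrFun (he c) (σ j)).symm)
  have hminor : (⟨n, fun c => u (e c)⟩ : Σ m, (Fin m → Bool) → Bool) ∈ Pol Δ :=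
    fun P hP ss hss => hg P hP (fun j => ss (σ j)) (fun j => hss (σ j)) _ fun i =>
      hge fun a => ss a i
  rw [hPol] at hminor
  have h := hminor _ rfl T Set.mem_range_self
  convert h using 1
  funext i
  refine Option.some_injective _ ?_
  rw [← hge, ← hu i]
  simp only [hσ]

theorem stmt9 :
    IsWeakBase { t : Fin 8 → Bool |
      ((t 0 = true ∧ t 1 = false ∧ t 2 = false) ∨
       (t 0 = false ∧ t 1 = true ∧ t 2 = false) ∨
       (t 0 = false ∧ t 1 = false ∧ t 2 = true)) ∧
      t 3 = ! t 0 ∧ t 4 = ! t 1 ∧ t 5 = ! t 2 ∧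
      t 6 = false ∧ t 7 = true } := by
  have hR := isWeakBase_range
    ![![true, false, false, false, true, true, false, true],
      ![false, true, false, true, false, true, false, true],
      ![false, false, true, true, true, false, false, true]] (by decide)
  convert hR using 1
  ext t
  simp only [Set.mem_ofPred_eq, Set.mem_range, Fin.exists_fin_succ, funext_iff, Fin.forall_fin_succ]
  constructor
  · rintro ⟨⟨h0, h1, h2⟩ | ⟨h0, h1, h2⟩ | ⟨h0, h1, h2⟩, h3, h4, h5, h6, h7⟩ <;>
      simp_all
  · simp
    grind
end
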